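/- There is an absolute constant c > 0 such that the following holds. Let n ∈ ℕ, η ∈ (1/n, 0.001], R ≥ 2, p ∈ (0, 1/R], and let S ⊆ {1,…,n} with |S| = ⌈η·n⌉. Define symmetric zero-diagonal matrices Q₀, Q₁ ∈ [0,1]^{n×n} by: for i ≠ j, (Q₀)_ij = R·p if i ∈ S or j ∈ S, and (Q₀)_ij = p otherwise; (Q₁)_ij = 0 if i ∈ S or j ∈ S, and (Q₁)_ij = p otherwise. For b ∈ {0,1} let p̄_b := Σ_{i,j}(Q_b)_ij/(n²−n). Suppose a randomized algorithm 𝒜 satisfies: for each b ∈ {0,1} and every graph G' that is an η-corrupted version of a sample G drawn from G(n,Q_b), Pr[ |𝒜(G')/p̄_b − 1| ≤ α ] ≥ 0.99. Then α ≥ c·min(R·η, 1). -/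

import Mathlib

open scoped BigOperators Classical

namespace EdgeDensity

/-- A graph on `n` nodes, identified with its Boolean adjacency function:
symmetric with no self-loops. -/
def IsGraph {n : ℕ} (A : Fin n → Fin n → Bool) : Prop :=
  (∀ i j, A i j = A j i) ∧ ∀ i, A i i = false

/-- The real adjacency matrix of a Boolean graph. -/
def adjMat {n : ℕ} (A : Fin n → Fin n → Bool) : Matrix (Fin n) (Fin n) ℝ :=
  Matrix.of fun i j => if A i j then 1 else 0

/-- `d(M) = (1/n) ∑_{i,j} M i j`, the average row sum. -/
noncomputable def dbar {n : ℕ} (M : Matrix (Fin n) (Fin n) ℝ) : ℝ :=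
  (∑ i, ∑ j, M i j) / n

/-- `(M 𝟙)_i = ∑_j M i j`, the `i`-th row sum (degree of node `i`). -/
def rowSum {n : ℕ} (M : Matrix (Fin n) (Fin n) ℝ) (i : Fin n) : ℝ := ∑ j, M i j

/-- The probability that the inhomogeneous random graph `G(n,Q)` equals the
given graph `A`: each edge `{i,j}` with `i < j` is present independently with
probability `Q i j`. -/
noncomputable def erWeight {n : ℕ} (Q : Matrix (Fin n) (Fin n) ℝ)
    (A : Fin n → Fin n → Bool) : ℝ :=
  ∏ i, ∏ j ∈ Finset.univ.filter (fun j => i < j),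
    (if A i j then Q i j else 1 - Q i j)

/-- Probability of the event `E` under the inhomogeneous random graph `G(n,Q)`. -/
noncomputable def erProb {n : ℕ} (Q : Matrix (Fin n) (Fin n) ℝ)
    (E : (Fin n → Fin n → Bool) → Prop) : ℝ :=
  ∑ A ∈ Finset.univ.filter (fun A => IsGraph A ∧ E A), erWeight Q A

/-- Node distance between two graphs: the minimum cardinality of a set `S` of
nodes such that the two adjacency matrices agree on all entries `(i,j)` with
`i ∉ S` and `j ∉ S`. -/
noncomputable def nodeDist {n : ℕ} (A B : Fin n → Fin n → Bool) : ℕ :=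
  sInf {k | ∃ S : Finset (Fin n), S.card = k ∧
    ∀ i j, i ∉ S → j ∉ S → A i j = B i j}

/-- The feasibility constraints `P1(A, γ)` on a pair `(Y, z)`. -/
def P1 {n : ℕ} (A : Matrix (Fin n) (Fin n) ℝ) (γ : ℝ)
    (Y : Matrix (Fin n) (Fin n) ℝ) (z : Fin n → ℝ) : Prop :=
  (∀ i, z i = 0 ∨ z i = 1) ∧
  ((1 - γ) * n ≤ ∑ i, z i) ∧
  (∀ i j, Y i j = Y j i) ∧
  (∀ i j, 0 ≤ Y i j ∧ Y i j ≤ 1) ∧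
  (∀ i j, Y i j * z i * z j = A i j * z i * z j)

/-- The binomial probability mass function `Bin(n,p)` at `k`. -/
noncomputable def binomPMF (n : ℕ) (p : ℝ) (k : ℕ) : ℝ :=
  (n.choose k : ℝ) * p ^ k * (1 - p) ^ (n - k)

/-- Total variation distance between `Bin(n,p)` and `Bin(n,q)`. -/
noncomputable def binomTV (n : ℕ) (p q : ℝ) : ℝ :=
  (∑ k ∈ Finset.range (n + 1), |binomPMF n p k - binomPMF n q k|) / 2

/-- The spectral norm (largest singular value) of a real square matrix. -/
noncomputable def specNorm {n : ℕ} (M : Matrix (Fin n) (Fin n) ℝ) : ℝ :=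
  ‖LinearMap.toContinuousLinearMap (Matrix.toEuclideanLin M)‖

/-- A randomized algorithm on `n`-node graphs is `ε`-differentially
node-private. -/
def IsNodeDP {n : ℕ} (ε : ℝ)
    (𝒜 : (Fin n → Fin n → Bool) → MeasureTheory.Measure ℝ) : Prop :=
  ∀ G G', IsGraph G → IsGraph G' → nodeDist G G' ≤ 1 →
    ∀ S : Set ℝ, MeasurableSet S →
      𝒜 G S ≤ ENNReal.ofReal (Real.exp ε) * 𝒜 G' S

/-- `Pr_{G ~ G(n,Q), 𝒜}[𝒜(G) ∈ S]`. -/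
noncomputable def algProb {n : ℕ} (Q : Matrix (Fin n) (Fin n) ℝ)
    (𝒜 : (Fin n → Fin n → Bool) → MeasureTheory.Measure ℝ) (S : Set ℝ) : ℝ :=
  ∑ A ∈ Finset.univ.filter (fun A => IsGraph A), erWeight Q A * (𝒜 A S).toReal


/-- The adjacency function agreeing with `A` on the pairs satisfying `P` and with `B` elsewhere. -/
noncomputable def mixOn {n : ℕ} (P : Fin n → Fin n → Prop) (A B : Fin n → Fin n → Bool) :
    Fin n → Fin n → Bool :=
  fun i j => if P i j then A i j else B i j

theorem IsGraph.mixOn {n : ℕ} {P : Fin n → Fin n → Prop} (hP : ∀ i j, P i j ↔ P j i)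
    {A B : Fin n → Fin n → Bool} (hA : IsGraph A) (hB : IsGraph B) :
    IsGraph (mixOn P A B) := by
  refine ⟨fun i j => ?_, fun i => ?_⟩
  · simp only [EdgeDensity.mixOn, hP i j, hA.1 i j, hB.1 i j]
  · simp only [EdgeDensity.mixOn, hA.2 i, hB.2 i, ite_self]

theorem nodeDist_le_card {n : ℕ} {A B : Fin n → Fin n → Bool} (T : Finset (Fin n))
    (h : ∀ i j, i ∉ T → j ∉ T → A i j = B i j) : nodeDist A B ≤ T.card :=
  Nat.sInf_le ⟨T, rfl, h⟩

theorem erWeight_nonneg {n : ℕ} {Q : Matrix (Fin n) (Fin n) ℝ}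
    (hQ : ∀ i j, 0 ≤ Q i j ∧ Q i j ≤ 1) (A : Fin n → Fin n → Bool) : 0 ≤ erWeight Q A := by
  refine Finset.prod_nonneg fun i _ => Finset.prod_nonneg fun j _ => ?_
  split_ifs
  · exact (hQ i j).1
  · linarith [(hQ i j).2]

theorem sum_prod_le_one_of_injOn {ι κ : Type*} [Fintype ι] {w : ι → Bool → ℝ}
    (hw : ∀ e b, 0 ≤ w e b) (hw1 : ∀ e, ∑ b, w e b = 1) {s : Finset κ} {r : κ → ι → Bool}
    (hr : Set.InjOn r s) : ∑ a ∈ s, ∏ e, w e (r a e) ≤ 1 :=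
  calc ∑ a ∈ s, ∏ e, w e (r a e)
      = ∑ g ∈ s.image r, ∏ e, w e (g e) :=
        (Finset.sum_image (f := fun g => ∏ e, w e (g e)) hr).symm
    _ ≤ ∑ g : ι → Bool, ∏ e, w e (g e) :=
        Finset.sum_le_sum_of_subset_of_nonneg (Finset.subset_univ _)
          fun _ _ _ => Finset.prod_nonneg fun e _ => hw e _
    _ = ∏ e, ∑ b, w e b := (Fintype.prod_sum w).symm
    _ = 1 := Finset.prod_eq_one fun e _ => hw1 e

theorem erWeight_eq_prod_subtype {n : ℕ} (Q : Matrix (Fin n) (Fin n) ℝ)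
    (A : Fin n → Fin n → Bool) :
    erWeight Q A = ∏ e : {e : Fin n × Fin n // e.1 < e.2},
      (if A e.1.1 e.1.2 then Q e.1.1 e.1.2 else 1 - Q e.1.1 e.1.2) := by
  rw [← Finset.prod_subtype (Finset.univ.filter fun e : Fin n × Fin n => e.1 < e.2)
    (by simp) (fun e => if A e.1 e.2 then Q e.1 e.2 else 1 - Q e.1 e.2), Finset.prod_filter,
    ← Finset.univ_product_univ, Finset.prod_product]
  simp only [erWeight, Finset.prod_filter]

theorem sum_erWeight_le_one {n : ℕ} {Q : Matrix (Fin n) (Fin n) ℝ}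
    (hQ : ∀ i j, 0 ≤ Q i j ∧ Q i j ≤ 1) :
    ∑ A ∈ Finset.univ.filter (fun A : Fin n → Fin n → Bool => IsGraph A), erWeight Q A ≤ 1 := by
  simp only [erWeight_eq_prod_subtype]
  refine sum_prod_le_one_of_injOn
    (w := fun (e : {e : Fin n × Fin n // e.1 < e.2}) b =>
      if b then Q e.1.1 e.1.2 else 1 - Q e.1.1 e.1.2)
    (r := fun (A : Fin n → Fin n → Bool) e => A e.1.1 e.1.2) (fun e b => ?_) (fun e => by simp) ?_
  · cases b
    · simpa using (hQ e.1.1 e.1.2).2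
    · simpa using (hQ e.1.1 e.1.2).1
  · intro A hA B hB h
    simp only [Finset.coe_filter, Finset.mem_univ, true_and, Set.mem_ofPred_eq] at hA hB
    funext i j
    rcases lt_trichotomy i j with hij | rfl | hij
    · exact congrFun h ⟨(i, j), hij⟩
    · rw [hA.2, hB.2]
    · rw [hA.1, hB.1]
      exact congrFun h ⟨(j, i), hij⟩

/-- Exchanging the edges on which two edge probability matrices agree preserves the product
weight. -/
theorem erWeight_mixOn_mul {n : ℕ} {Q Q' : Matrix (Fin n) (Fin n) ℝ}
    {P : Fin n → Fin n → Prop} (h : ∀ i j, P i j → Q i j = Q' i j)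
    (A B : Fin n → Fin n → Bool) :
    erWeight Q (mixOn P A B) * erWeight Q' (mixOn P B A) = erWeight Q B * erWeight Q' A := by
  simp only [erWeight, ← Finset.prod_mul_distrib]
  refine Finset.prod_congr rfl fun i _ => Finset.prod_congr rfl fun j _ => ?_
  by_cases hP : P i j
  · simp only [mixOn, hP, if_true, h i j hP]
    exact mul_comm _ _
  · simp only [mixOn, hP, if_false]

theorem sum_sum_exchange {n : ℕ} {Q Q' : Matrix (Fin n) (Fin n) ℝ}
    {P : Fin n → Fin n → Prop} (hP : ∀ i j, P i j ↔ P j i) (h : ∀ i j, P i j → Q i j = Q' i j)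
    (F : (Fin n → Fin n → Bool) → (Fin n → Fin n → Bool) → ℝ) :
    ∑ B ∈ Finset.univ.filter (fun A : Fin n → Fin n → Bool => IsGraph A),
      ∑ A ∈ Finset.univ.filter (fun A : Fin n → Fin n → Bool => IsGraph A),
        erWeight Q B * erWeight Q' A * F (mixOn P A B) (mixOn P B A) =
    ∑ B ∈ Finset.univ.filter (fun A : Fin n → Fin n → Bool => IsGraph A),
      ∑ A ∈ Finset.univ.filter (fun A : Fin n → Fin n → Bool => IsGraph A),
        erWeight Q B * erWeight Q' A * F B A := by
  have hmix : ∀ A B : Fin n → Fin n → Bool, mixOn P (mixOn P A B) (mixOn P B A) = A := by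
    intro A B
    funext i j
    by_cases hij : P i j <;> simp [mixOn, hij]
  rw [← Finset.sum_product', ← Finset.sum_product']
  refine Finset.sum_nbij' (fun x => (mixOn P x.2 x.1, mixOn P x.1 x.2))
    (fun x => (mixOn P x.2 x.1, mixOn P x.1 x.2)) ?_ ?_ ?_ ?_ ?_
  · simp only [Finset.mem_product, Finset.mem_filter, Finset.mem_univ, true_and]
    exact fun x hx => ⟨hx.2.mixOn hP hx.1, hx.1.mixOn hP hx.2⟩
  · simp only [Finset.mem_product, Finset.mem_filter, Finset.mem_univ, true_and]
    exact fun x hx => ⟨hx.2.mixOn hP hx.1, hx.1.mixOn hP hx.2⟩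
  · intro x _
    simp only [hmix]
  · intro x _
    simp only [hmix]
  · intro x _
    simp only [erWeight_mixOn_mul h]

/-- If `Q` and `Q'` agree off two node sets `T`, `T'`, no randomized algorithm can be accurate for
two disjoint targets when it is fed samples of `G(n,Q)` corrupted on `T` and samples of `G(n,Q')`
corrupted on `T'`. -/
theorem not_disjoint_of_accurate {n : ℕ} {Q Q' : Matrix (Fin n) (Fin n) ℝ}
    (hQ : ∀ i j, 0 ≤ Q i j ∧ Q i j ≤ 1) (hQ' : ∀ i j, 0 ≤ Q' i j ∧ Q' i j ≤ 1)
    {T T' : Finset (Fin n)} {k : ℝ} (hT : (T.card : ℝ) ≤ k) (hT' : (T'.card : ℝ) ≤ k)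
    (hagree : ∀ i j, i ∉ T → i ∉ T' → j ∉ T → j ∉ T' → Q i j = Q' i j)
    (𝒜 : (Fin n → Fin n → Bool) → MeasureTheory.Measure ℝ)
    [∀ G, MeasureTheory.IsProbabilityMeasure (𝒜 G)] {U U' : Set ℝ} (hU' : MeasurableSet U')
    (h : ∀ f : (Fin n → Fin n → Bool) → (Fin n → Fin n → Bool),
      (∀ G, IsGraph G → IsGraph (f G) ∧ (nodeDist G (f G) : ℝ) ≤ k) →
      0.99 ≤ ∑ A ∈ Finset.univ.filter (fun A => IsGraph A),
        erWeight Q A * ((𝒜 (f A)) U).toReal)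
    (h' : ∀ f : (Fin n → Fin n → Bool) → (Fin n → Fin n → Bool),
      (∀ G, IsGraph G → IsGraph (f G) ∧ (nodeDist G (f G) : ℝ) ≤ k) →
      0.99 ≤ ∑ A ∈ Finset.univ.filter (fun A => IsGraph A),
        erWeight Q' A * ((𝒜 (f A)) U').toReal) :
    ¬ Disjoint U U' := by
  intro hdisj
  let P₀ : Fin n → Fin n → Prop := fun i j => i ∈ T ∨ j ∈ T
  let P₁ : Fin n → Fin n → Prop := fun i j => (i ∈ T' ∨ j ∈ T') ∧ ¬ (i ∈ T ∨ j ∈ T)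
  let P : Fin n → Fin n → Prop := fun i j => ¬ (i ∈ T' ∨ j ∈ T') ∧ ¬ (i ∈ T ∨ j ∈ T)
  have hP₀ : ∀ i j, P₀ i j ↔ P₀ j i := fun i j => or_comm
  have hP₁ : ∀ i j, P₁ i j ↔ P₁ j i := fun i j => by simp only [P₁]; tauto
  have hP : ∀ i j, P i j ↔ P j i := fun i j => by simp only [P]; tauto
  have hPQ : ∀ i j, P i j → Q i j = Q' i j := fun i j hij => by
    simp only [P, not_or] at hij
    exact hagree i j hij.2.1 hij.1.1 hij.2.2 hij.1.2
  set 𝒢 := Finset.univ.filter (fun A : Fin n → Fin n → Bool => IsGraph A) with h𝒢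
  have hmem : ∀ A, A ∈ 𝒢 ↔ IsGraph A := fun A => by simp [h𝒢]
  have hw := erWeight_nonneg hQ
  have hw' := erWeight_nonneg hQ'
  have hone := sum_erWeight_le_one hQ
  have hone' := sum_erWeight_le_one hQ'
  rw [← h𝒢] at hone hone'
  have hsum : ∀ G, ((𝒜 G) U).toReal + ((𝒜 G) U').toReal ≤ 1 := fun G => by
    have := MeasureTheory.measureReal_union (μ := 𝒜 G) hdisj hU'
    simp only [MeasureTheory.Measure.real] at this
    rw [← this]
    exact MeasureTheory.measureReal_le_one
  have hprob : ∀ (G) (V : Set ℝ), ((𝒜 G) V).toReal ≤ 1 := fun G V =>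
    MeasureTheory.measureReal_le_one
  have hbound : ∀ A ∈ 𝒢, 0.99 ≤ ∑ B ∈ 𝒢, erWeight Q B * ((𝒜 (mixOn P₀ A B)) U).toReal := by
    intro A hA
    refine h (fun B => mixOn P₀ A B) fun B hB => ⟨((hmem A).1 hA).mixOn hP₀ hB, ?_⟩
    refine le_trans (Nat.cast_le.2 (nodeDist_le_card T fun i j hi hj => ?_)) hT
    simp [mixOn, P₀, hi, hj]
  have hbound' : ∀ B ∈ 𝒢, 0.99 ≤ ∑ A ∈ 𝒢, erWeight Q' A * ((𝒜 (mixOn P₁ B A)) U').toReal := by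
    intro B hB
    refine h' (fun A => mixOn P₁ B A) fun A hA => ⟨((hmem B).1 hB).mixOn hP₁ hA, ?_⟩
    refine le_trans (Nat.cast_le.2 (nodeDist_le_card T' fun i j hi hj => ?_)) hT'
    simp [mixOn, P₁, hi, hj]
  have hmix : ∀ A B : Fin n → Fin n → Bool,
      mixOn P₁ (mixOn P A B) (mixOn P B A) = mixOn P₀ A B := by
    intro A B
    funext i j
    by_cases h1 : i ∈ T ∨ j ∈ T <;> by_cases h2 : i ∈ T' ∨ j ∈ T' <;>
      simp only [mixOn, P₁, P₀, P, h1, h2, not_true_eq_false, not_false_eq_true, and_true,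
        and_false, if_true, if_false]
  have hlow : ∑ A ∈ 𝒢, erWeight Q' A * 0.99 ≤
      ∑ B ∈ 𝒢, ∑ A ∈ 𝒢, erWeight Q B * erWeight Q' A * ((𝒜 (mixOn P₀ A B)) U).toReal := by
    rw [Finset.sum_comm]
    refine Finset.sum_le_sum fun A hA => ?_
    refine (mul_le_mul_of_nonneg_left (hbound A hA) (hw' A)).trans_eq ?_
    rw [Finset.mul_sum]
    exact Finset.sum_congr rfl fun B _ => by ring
  have hlow' : ∑ B ∈ 𝒢, erWeight Q B * 0.99 ≤
      ∑ B ∈ 𝒢, ∑ A ∈ 𝒢, erWeight Q B * erWeight Q' A * ((𝒜 (mixOn P₀ A B)) U').toReal := by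
    have hex := sum_sum_exchange hP hPQ fun B A => ((𝒜 (mixOn P₁ B A)) U').toReal
    simp only [hmix] at hex
    rw [h𝒢, hex, ← h𝒢]
    refine Finset.sum_le_sum fun B hB => ?_
    refine (mul_le_mul_of_nonneg_left (hbound' B hB) (hw B)).trans_eq ?_
    rw [Finset.mul_sum]
    exact Finset.sum_congr rfl fun A _ => by ring
  have hup : ∑ B ∈ 𝒢, ∑ A ∈ 𝒢, erWeight Q B * erWeight Q' A * ((𝒜 (mixOn P₀ A B)) U).toReal +
      ∑ B ∈ 𝒢, ∑ A ∈ 𝒢, erWeight Q B * erWeight Q' A * ((𝒜 (mixOn P₀ A B)) U').toReal ≤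
      (∑ B ∈ 𝒢, erWeight Q B) * ∑ A ∈ 𝒢, erWeight Q' A := by
    rw [Finset.sum_mul_sum, ← Finset.sum_add_distrib]
    refine Finset.sum_le_sum fun B _ => ?_
    rw [← Finset.sum_add_distrib]
    refine Finset.sum_le_sum fun A _ => ?_
    rw [← mul_add]
    exact mul_le_of_le_one_right (mul_nonneg (hw B) (hw' A)) (hsum _)
  have hid : ∀ G, IsGraph G → IsGraph (id G) ∧ (nodeDist G (id G) : ℝ) ≤ k := fun G hG =>
    ⟨hG, le_trans (Nat.cast_le.2 (nodeDist_le_card T fun _ _ _ _ => rfl)) hT⟩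
  have hge : 0.99 ≤ ∑ B ∈ 𝒢, erWeight Q B := (h id hid).trans <|
    Finset.sum_le_sum fun B _ => mul_le_of_le_one_right (hw B) (hprob _ _)
  have hge' : 0.99 ≤ ∑ A ∈ 𝒢, erWeight Q' A := (h' id hid).trans <|
    Finset.sum_le_sum fun A _ => mul_le_of_le_one_right (hw' A) (hprob _ _)
  rw [← Finset.sum_mul] at hlow hlow'
  nlinarith

theorem sum_offDiag_compl {n : ℕ} (S : Finset (Fin n)) (a b : ℝ) :
    ∑ i, ∑ j, (if i = j then 0 else if i ∈ S ∨ j ∈ S then a else b) =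
      a * ((n : ℝ) ^ 2 - n) + (b - a) * (((n : ℝ) - S.card) ^ 2 - ((n : ℝ) - S.card)) := by
  have hS : S.card ≤ n := by simpa using S.card_le_univ
  have hoff : ∀ T : Finset (Fin n), ∑ i, ∑ j, (if i ≠ j ∧ i ∈ T ∧ j ∈ T then (1 : ℝ) else 0) =
      (T.card : ℝ) ^ 2 - T.card := by
    intro T
    have hfilter : Finset.univ.filter (fun x : Fin n × Fin n => x.1 ≠ x.2 ∧ x.1 ∈ T ∧ x.2 ∈ T) =
        T.offDiag := by
      ext x
      simp only [Finset.mem_filter, Finset.mem_univ, true_and, Finset.mem_offDiag]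
      tauto
    rw [← Finset.sum_product', Finset.univ_product_univ, Finset.sum_boole, hfilter,
      Finset.offDiag_card, Nat.cast_sub (Nat.le_mul_self _)]
    push_cast
    ring
  have huniv := hoff Finset.univ
  have hcompl := hoff Sᶜ
  rw [Finset.card_compl, Fintype.card_fin, Nat.cast_sub hS] at hcompl
  rw [Finset.card_univ, Fintype.card_fin] at huniv
  rw [← huniv, ← hcompl, Finset.mul_sum, Finset.mul_sum, ← Finset.sum_add_distrib]
  refine Finset.sum_congr rfl fun i _ => ?_
  rw [Finset.mul_sum, Finset.mul_sum, ← Finset.sum_add_distrib]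
  refine Finset.sum_congr rfl fun j _ => ?_
  by_cases hij : i = j
  · simp [hij]
  · by_cases hi : i ∈ S <;> by_cases hj : j ∈ S <;> simp [hij, hi, hj]

/-- Relative accuracy intervals around `p (1 + (R - 1) t)` and `p (1 - t)` are disjoint when the
accuracy is below `min (R t) 1 / 3`. -/
theorem disjoint_relative_accuracy {p R t m α : ℝ} (hp : 0 < p) (hR : 2 ≤ R) (ht : 0 ≤ t)
    (ht1 : t < 1) (hm1 : m ≤ 1) (hm : m ≤ R * t) (hα : α < m / 3) :
    Disjoint {x : ℝ | |x / (p * (1 + (R - 1) * t)) - 1| ≤ α}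
      {x : ℝ | |x / (p * (1 - t)) - 1| ≤ α} := by
  rw [Set.disjoint_left]
  intro x hx hx'
  simp only [Set.mem_ofPred_eq, abs_le] at hx hx'
  have hRt : 0 ≤ (R - 2) * t := mul_nonneg (by linarith) ht
  have h0 : 0 < p * (1 + (R - 1) * t) := mul_pos hp (by linarith)
  have h1 : 0 < p * (1 - t) := mul_pos hp (by linarith)
  have hlow : (1 - α) * (p * (1 + (R - 1) * t)) ≤ x := by
    rw [← le_div_iff₀ h0]; linarith
  have hup : x ≤ (1 + α) * (p * (1 - t)) := by
    rw [← div_le_iff₀ h1]; linarith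
  have hle : p * ((1 - α) * (1 + (R - 1) * t)) ≤ p * ((1 + α) * (1 - t)) := by linarith
  have hle' := le_of_mul_le_mul_left hle hp
  have h2 : α * (2 + (R - 2) * t) < m / 3 * (2 + (R - 2) * t) :=
    mul_lt_mul_of_pos_right hα (by linarith)
  have h3 : m * ((R - 2) * t) ≤ (R - 2) * t := mul_le_of_le_one_left hRt hm1
  linarith

/-- robustness lower bound for inhomogeneous random graphs. -/
theorem robust_lower_bound_inhomo :
    ∃ c > (0 : ℝ), ∀ (n : ℕ) (η R p α : ℝ) (S : Finset (Fin n))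
      (𝒜 : (Fin n → Fin n → Bool) → MeasureTheory.Measure ℝ)
      (Q₀ Q₁ : Matrix (Fin n) (Fin n) ℝ) (pbar₀ pbar₁ : ℝ),
      1 / n < η → η ≤ 0.001 → 2 ≤ R → 0 < p → p ≤ 1 / R →
      S.card = ⌈η * n⌉₊ →
      Q₀ = Matrix.of (fun i j =>
        if i = j then 0 else if i ∈ S ∨ j ∈ S then R * p else p) →
      Q₁ = Matrix.of (fun i j =>
        if i = j then 0 else if i ∈ S ∨ j ∈ S then 0 else p) →
      pbar₀ = (∑ i, ∑ j, Q₀ i j) / ((n : ℝ) ^ 2 - n) →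
      pbar₁ = (∑ i, ∑ j, Q₁ i j) / ((n : ℝ) ^ 2 - n) →
      (∀ G, MeasureTheory.IsProbabilityMeasure (𝒜 G)) →
      (∀ f : (Fin n → Fin n → Bool) → (Fin n → Fin n → Bool),
        (∀ G, IsGraph G → IsGraph (f G) ∧ (nodeDist G (f G) : ℝ) ≤ η * n) →
        0.99 ≤ ∑ A ∈ Finset.univ.filter (fun A => IsGraph A),
          erWeight Q₀ A * ((𝒜 (f A)) {x | |x / pbar₀ - 1| ≤ α}).toReal) →
      (∀ f : (Fin n → Fin n → Bool) → (Fin n → Fin n → Bool),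
        (∀ G, IsGraph G → IsGraph (f G) ∧ (nodeDist G (f G) : ℝ) ≤ η * n) →
        0.99 ≤ ∑ A ∈ Finset.univ.filter (fun A => IsGraph A),
          erWeight Q₁ A * ((𝒜 (f A)) {x | |x / pbar₁ - 1| ≤ α}).toReal) →
      c * min (R * η) 1 ≤ α := by
  refine ⟨1 / 3, by norm_num, ?_⟩
  intro n η R p α S 𝒜 Q₀ Q₁ pbar₀ pbar₁ hη hη' hR hp hpR hS hQ₀ hQ₁ hp₀ hp₁ h𝒜 h₀ h₁
  by_contra! hlt
  have hn0 : (0 : ℝ) < n := by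
    rcases Nat.eq_zero_or_pos n with rfl | hn
    · have hmin : min (R * η) 1 ≤ 1 := min_le_right _ _
      have hα : ¬ 1 ≤ α := by linarith
      have h := h₀ id fun G hG =>
        ⟨hG, by simpa using nodeDist_le_card (A := G) (B := G) ∅ fun _ _ _ _ => rfl⟩
      norm_num [hp₀, hα] at h
    · exact_mod_cast hn
  have hηn : 1 < η * n := by rwa [div_lt_iff₀ hn0] at hη
  have hη0 : 0 < η := lt_trans (by positivity) hη
  have hn : (1000 : ℝ) < n := by norm_num at hη'; nlinarith
  have hRp : R * p ≤ 1 := by rwa [le_div_iff₀ (by linarith), mul_comm] at hpR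
  have hRp0 : 0 < R * p := mul_pos (by linarith) hp
  have hp1 : p ≤ 1 := by nlinarith
  have hs : η * n ≤ S.card := hS ▸ Nat.le_ceil _
  have hs' : (S.card : ℝ) < η * n + 1 := hS ▸ Nat.ceil_lt_add_one (by linarith)
  obtain ⟨T, hTS, hT⟩ := Finset.exists_subset_card_eq (hS ▸ Nat.floor_le_ceil (η * n))
  have hTle : (T.card : ℝ) ≤ η * n := hT ▸ Nat.floor_le (by linarith)
  have hTle' : ((S \ T).card : ℝ) ≤ η * n := by
    have hle : (S \ T).card ≤ 1 := by
      rw [Finset.card_sdiff_of_subset hTS, hS, hT]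
      have := Nat.ceil_le_floor_add_one (η * n)
      omega
    have : ((S \ T).card : ℝ) ≤ 1 := by exact_mod_cast hle
    linarith
  have hb₀ : ∀ i j, 0 ≤ Q₀ i j ∧ Q₀ i j ≤ 1 := fun i j => by
    rw [hQ₀, Matrix.of_apply]; split_ifs <;> constructor <;> linarith
  have hb₁ : ∀ i j, 0 ≤ Q₁ i j ∧ Q₁ i j ≤ 1 := fun i j => by
    rw [hQ₁, Matrix.of_apply]; split_ifs <;> constructor <;> linarith
  have hagree : ∀ i j, i ∉ T → i ∉ S \ T → j ∉ T → j ∉ S \ T → Q₀ i j = Q₁ i j := by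
    intro i j hi hi' hj hj'
    have hiS : i ∉ S := fun h => hi' (Finset.mem_sdiff.2 ⟨h, hi⟩)
    have hjS : j ∉ S := fun h => hj' (Finset.mem_sdiff.2 ⟨h, hj⟩)
    simp [hQ₀, hQ₁, hiS, hjS]
  set s : ℝ := (S.card : ℝ)
  set N : ℝ := (n : ℝ) ^ 2 - n with hN
  set K : ℝ := ((n : ℝ) - s) ^ 2 - (n - s) with hK
  have hN0 : 0 < N := by rw [hN]; nlinarith
  have hsn : s + 2 ≤ n := by norm_num at hη'; nlinarith
  have hK0 : 0 < K := by rw [hK]; nlinarith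
  have hηt : η ≤ 1 - K / N := by
    have : K / N ≤ 1 - η := by
      have h1 : (n - s) * (n - 1) ≤ (1 - η) * n * (n - 1) :=
        mul_le_mul_of_nonneg_right (by linarith) (by linarith)
      rw [div_le_iff₀ hN0, hK, hN]
      nlinarith
    linarith
  have e₀ : pbar₀ = p * (1 + (R - 1) * (1 - K / N)) := by
    rw [hp₀, hQ₀]
    simp only [Matrix.of_apply]
    rw [sum_offDiag_compl, ← hN, ← hK]
    field_simp
    ring
  have e₁ : pbar₁ = p * (1 - (1 - K / N)) := by
    rw [hp₁, hQ₁]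
    simp only [Matrix.of_apply]
    rw [sum_offDiag_compl, ← hN, ← hK]
    field_simp
    ring
  refine not_disjoint_of_accurate hb₀ hb₁ hTle hTle' hagree 𝒜 ?_ h₀ h₁ ?_
  · exact measurableSet_le (by fun_prop) measurable_const
  · rw [e₀, e₁]
    exact disjoint_relative_accuracy hp hR (by linarith) (by linarith [div_pos hK0 hN0])
      (min_le_right (R * η) 1)
      ((min_le_left _ _).trans (mul_le_mul_of_nonneg_left hηt (by linarith))) (by linarith)

end EdgeDensity
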